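/- Let 1 ≤ k ≤ n. For every degree d ≥ 0 there is an isomorphism of S_n-representations (S_{n,k})_d ≅ ⊕_{j=k}^{n} (R_{n,j})_{d−(n−j)}, where (S_{n,k})_d and (R_{n,j})_{d−(n−j)} denote the degree-d and degree-(d−(n−j)) homogeneous components of the graded rings S_{n,k} and R_{n,j} respectively (taken to be zero in negative degrees). Equivalently, S_{n,k} ≅ R_{n,n}⟨0⟩ ⊕ R_{n,n−1}⟨−1⟩ ⊕ ⋯ ⊕ R_{n,k}⟨−(n−k)⟩ as graded S_n-modules. -/

import Mathlib

open scoped BigOperators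

namespace PackedWords

/-- An ordered set partition of `[n] = {1, …, n}` with `k` blocks: a sequence
`B_1 | ⋯ | B_k` of nonempty pairwise disjoint subsets of `[n]` whose union is `[n]`. -/
structure OSP (n k : ℕ) where
  blocks : Fin k → Finset ℕ
  subset_range : ∀ j, blocks j ⊆ Finset.Icc 1 n
  blocks_nonempty : ∀ j, (blocks j).Nonempty
  blocks_disjoint : ∀ j₁ j₂ : Fin k, j₁ ≠ j₂ → Disjoint (blocks j₁) (blocks j₂)
  cover : ∀ i ∈ Finset.Icc 1 n, ∃ j, i ∈ blocks j

/-- Common generalization of the coinversion code (`b = 0`) and the boosted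
coinversion code (`b = 1`).  Position `p : Fin n` corresponds to the letter
`i = p + 1` of `[n]`.  If `i ∈ B_j` (blocks indexed `0, …, k-1`, so `j` here is
the paper's `j - 1`), then `c_i = #{ℓ > j : min B_ℓ > i}` if `i = min B_j`, and
`c_i = #{ℓ > j : min B_ℓ > i} + (j - 1) + b` (in the paper's 1-indexing) otherwise. -/
noncomputable def codeAux {n k : ℕ} (b : ℕ) (σ : OSP n k) (p : Fin n) : ℕ :=
  if h : ∃ j, ((p : ℕ) + 1) ∈ σ.blocks j then
    (Finset.univ.filter fun ℓ : Fin k =>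
        h.choose < ℓ ∧ ∀ x ∈ σ.blocks ℓ, (p : ℕ) + 1 < x).card
      + (if ∀ x ∈ σ.blocks h.choose, (p : ℕ) + 1 ≤ x then 0 else (h.choose : ℕ) + b)
  else 0

/-- The coinversion code of an ordered set partition. -/
noncomputable def code {n k : ℕ} (σ : OSP n k) : Fin n → ℕ := codeAux 0 σ

/-- The boosted coinversion code of an ordered set partition. -/
noncomputable def bcode {n k : ℕ} (σ : OSP n k) : Fin n → ℕ := codeAux 1 σ

/-- The skip sequence of a finite set `S = {s_1 < s_2 < ⋯} ⊆ ℕ`: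
`γ_i = i - j + 1` if `i = s_j ∈ S`, and `γ_i = 0` otherwise. -/
def skip (S : Finset ℕ) (i : ℕ) : ℕ :=
  if i ∈ S then i - (S.filter (· < i)).card else 0

/-- The reverse skip sequence `γ(S)* = (γ_n, …, γ_1)` of `S ⊆ [n]`, read at
position `p : Fin n` (so position `p` carries `γ_{n - p}` in 1-indexed terms). -/
def revSkipAt (n : ℕ) (S : Finset ℕ) (p : Fin n) : ℕ := skip S (n - (p : ℕ))

/-- For `T ⊆ [n-1]` with skip sequence `γ = γ(T)`, the length-`n` sequence
`(γ_{n-1}, …, γ_i, d, γ_{i-1}, …, γ_1)` obtained from the reverse skip sequence of `T`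
by inserting `d` in position `n - i + 1` (1-indexed), read at position `p : Fin n`. -/
def insSeq (n i d : ℕ) (T : Finset ℕ) (p : Fin n) : ℕ :=
  if (p : ℕ) + 1 ≤ n - i then skip T (n - ((p : ℕ) + 1))
  else if (p : ℕ) + 1 = n - i + 1 then d
  else skip T (n - ((p : ℕ) + 1) + 1)

/-- `Packedk n k w`: `w` is a packed word of length `n` on the alphabet of positive
integers (whenever `i + 1` appears as a letter, so does `i`) in which each of the
letters `1, 2, …, k` appears. -/
def Packedk (n k : ℕ) (w : Fin n → ℕ) : Prop :=
  (∀ p, 1 ≤ w p) ∧ (∀ i, 1 ≤ i → (∃ p, w p = i + 1) → ∃ p, w p = i) ∧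
    (∀ j, 1 ≤ j → j ≤ k → ∃ p, w p = j)

/-- The elementary symmetric polynomial of degree `a` in the variables `X j`, `j ∈ s`. -/
noncomputable def esymmOn (n : ℕ) (s : Finset (Fin n)) (a : ℕ) : MvPolynomial (Fin n) ℚ :=
  ∑ t ∈ s.powersetCard a, ∏ j ∈ t, MvPolynomial.X j

/-- The complete homogeneous symmetric polynomial of degree `b` evaluated at
`α 1, α 2, …, α d`. -/
noncomputable def hval (b d : ℕ) (α : ℕ → ℚ) : ℚ :=
  ∑ m : Sym (Fin d) b, ((m : Multiset (Fin d)).map fun j => α ((j : ℕ) + 1)).prod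

/-- The locus `X_{n,k} ⊆ ℚ^n` of points `(α_{w_1}, …, α_{w_n})` for `w ∈ W_{n,k}`. -/
def packedPoints (n k : ℕ) (α : ℕ → ℚ) : Set (Fin n → ℚ) :=
  {x | ∃ w : Fin n → ℕ, Packedk n k w ∧ x = fun p => α (w p)}

/-- The ideal `J_n = ⟨x_i^d e_{n-r}^{(i)} : 1 ≤ i ≤ n, 1 ≤ r ≤ d⟩`. -/
noncomputable def Jn (n : ℕ) : Ideal (MvPolynomial (Fin n) ℚ) :=
  Ideal.span {g | ∃ (i : Fin n) (r d : ℕ), 1 ≤ r ∧ r ≤ d ∧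
    g = MvPolynomial.X i ^ d * esymmOn n {i}ᶜ (n - r)}

/-- The ideal `J_{n,k} = J_n + ⟨e_n, e_{n-1}, …, e_{n-k+1}⟩`. -/
noncomputable def Jnk (n k : ℕ) : Ideal (MvPolynomial (Fin n) ℚ) :=
  Jn n ⊔ Ideal.span {g | ∃ j : ℕ, n - k + 1 ≤ j ∧ j ≤ n ∧ g = esymmOn n Finset.univ j}

/-- The Haglund–Rhoades–Shimozono ideal
`I_{n,k} = ⟨x_1^k, …, x_n^k, e_n, e_{n-1}, …, e_{n-k+1}⟩`. -/
noncomputable def Ink (n k : ℕ) : Ideal (MvPolynomial (Fin n) ℚ) :=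
  Ideal.span ({g | ∃ i : Fin n, g = MvPolynomial.X i ^ k} ∪
    {g | ∃ j : ℕ, n - k + 1 ≤ j ∧ j ≤ n ∧ g = esymmOn n Finset.univ j})

/-- `T(X)`: the ideal generated by the top-degree homogeneous components `τ(f)` of
all nonzero polynomials `f` vanishing on `X`. -/
noncomputable def gradedIdeal (n : ℕ) (X : Set (Fin n → ℚ)) : Ideal (MvPolynomial (Fin n) ℚ) :=
  Ideal.span {g | ∃ f : MvPolynomial (Fin n) ℚ, f ≠ 0 ∧
    (∀ x ∈ X, MvPolynomial.eval x f = 0) ∧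
    g = MvPolynomial.homogeneousComponent f.totalDegree f}

/-- The degree-`d` homogeneous component of the quotient `ℚ[x_1, …, x_n]/I`,
namely the image of the space of homogeneous polynomials of degree `d`. -/
noncomputable def quotComp (n : ℕ) (I : Ideal (MvPolynomial (Fin n) ℚ)) (d : ℕ) :
    Submodule ℚ (MvPolynomial (Fin n) ℚ ⧸ I) :=
  Submodule.map (Ideal.Quotient.mkₐ ℚ I).toLinearMap
    (MvPolynomial.homogeneousSubmodule (Fin n) ℚ d)

/-- The degree-`(d - a)` homogeneous component of `ℚ[x_1, …, x_n]/I`, interpreted as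
zero when `d - a < 0` (degree shift by `a`). -/
noncomputable def quotCompShift (n : ℕ) (I : Ideal (MvPolynomial (Fin n) ℚ)) (d a : ℕ) :
    Submodule ℚ (MvPolynomial (Fin n) ℚ ⧸ I) :=
  if a ≤ d then quotComp n I (d - a) else ⊥

lemma packedk_comp {n k : ℕ} {w : Fin n → ℕ} (σ : Equiv.Perm (Fin n)) (h : Packedk n k w) :
    Packedk n k (w ∘ σ) := by
  obtain ⟨h1, h2, h3⟩ := h
  refine ⟨fun p => h1 _, fun i hi hex => ?_, fun j hj hjk => ?_⟩
  · obtain ⟨q, hq⟩ := h2 i hi (by obtain ⟨p, hp⟩ := hex; exact ⟨σ p, hp⟩)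
    exact ⟨σ.symm q, by simpa using hq⟩
  · obtain ⟨q, hq⟩ := h3 j hj hjk
    exact ⟨σ.symm q, by simpa using hq⟩

/-- The left action of a permutation `σ ∈ S_n` on packed words, sending `w` to
`w ∘ σ⁻¹` (the permutation action on positions). -/
noncomputable def wordPerm (n k : ℕ) (σ : Equiv.Perm (Fin n)) :
    {w : Fin n → ℕ // Packedk n k w} ≃ {w : Fin n → ℕ // Packedk n k w} where
  toFun w := ⟨w.1 ∘ σ.symm, packedk_comp σ.symm w.2⟩
  invFun w := ⟨w.1 ∘ σ, packedk_comp σ w.2⟩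
  left_inv w := Subtype.ext (funext fun p => by simp)
  right_inv w := Subtype.ext (funext fun p => by simp)


open MvPolynomial

/-- The elementary symmetric function of degree `a` in the values `f j`, `j ∈ s`. -/
def esymFun {ι R : Type*} [CommSemiring R] (f : ι → R) (s : Finset ι) (a : ℕ) : R :=
  ∑ t ∈ s.powersetCard a, ∏ j ∈ t, f j

section esymFun

variable {ι R : Type*} [CommSemiring R] (f : ι → R)

lemma esymFun_zero (s : Finset ι) : esymFun f s 0 = 1 := by simp [esymFun]

lemma esymFun_eq_zero {s : Finset ι} {a : ℕ} (h : s.card < a) : esymFun f s a = 0 := by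
  simp [esymFun, Finset.powersetCard_eq_empty.2 h]

lemma esymFun_insert [DecidableEq ι] {s : Finset ι} {i : ι} (hi : i ∉ s) (a : ℕ) :
    esymFun f (insert i s) (a + 1) = esymFun f s (a + 1) + f i * esymFun f s a := by
  have hmem : ∀ t ∈ s.powersetCard a, i ∉ t := fun t ht h =>
    hi ((Finset.mem_powersetCard.1 ht).1 h)
  rw [esymFun, Finset.powersetCard_succ_insert hi, Finset.sum_union, Finset.sum_image]
  · rw [esymFun, esymFun, Finset.mul_sum]
    congr 1
    exact Finset.sum_congr rfl fun t ht => Finset.prod_insert (hmem t ht)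
  · intro t ht t' ht' h
    rw [← Finset.erase_insert (hmem t ht), ← Finset.erase_insert (hmem t' ht'), h]
  · rw [Finset.disjoint_left]
    intro t ht h
    obtain ⟨t', -, rfl⟩ := Finset.mem_image.1 h
    exact hi ((Finset.mem_powersetCard.1 ht).1 (Finset.mem_insert_self _ _))

lemma esymFun_map {κ : Type*} (g : κ ↪ ι) (s : Finset κ) (a : ℕ) :
    esymFun f (s.map g) a = esymFun (fun j => f (g j)) s a := by
  simp [esymFun, Finset.powersetCard_map]

lemma map_esymFun {S F : Type*} [CommSemiring S] [FunLike F R S] [RingHomClass F R S]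
    (φ : F) (s : Finset ι) (a : ℕ) :
    φ (esymFun f s a) = esymFun (fun j => φ (f j)) s a := by
  simp [esymFun, map_sum, map_prod]

end esymFun

lemma esymmOn_eq (n : ℕ) (s : Finset (Fin n)) (a : ℕ) : esymmOn n s a = esymFun X s a := rfl

lemma isHomogeneous_esymmOn (n : ℕ) (s : Finset (Fin n)) (a : ℕ) :
    (esymmOn n s a).IsHomogeneous a := by
  refine IsHomogeneous.sum _ _ _ fun t ht => ?_
  have h := IsHomogeneous.prod t (fun j => (X j : MvPolynomial (Fin n) ℚ)) (fun _ => 1)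
    fun j _ => isHomogeneous_X ℚ j
  simpa [(Finset.mem_powersetCard.1 ht).2] using h

lemma rename_esymmOn {n : ℕ} (σ : Equiv.Perm (Fin n)) (s : Finset (Fin n)) (a : ℕ) :
    rename σ (esymmOn n s a) = esymmOn n (s.map σ.toEmbedding) a := by
  rw [esymmOn_eq, esymmOn_eq, esymFun_map, map_esymFun]
  simp

lemma esymmOn_succ (n a : ℕ) :
    esymmOn (n + 1) Finset.univ (a + 1) = rename Fin.succ (esymmOn n Finset.univ (a + 1)) +
      X 0 * rename Fin.succ (esymmOn n Finset.univ a) := by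
  classical
  simp only [esymmOn_eq, map_esymFun, rename_X]
  rw [Fin.univ_succ, Finset.cons_eq_insert, esymFun_insert _ (by simp), esymFun_map, esymFun_map]
  rfl

/-- The ideal `⟨x_1^k, …, x_n^k, e_n, …, e_{n-s+1}⟩` (the unit ideal if `s > n`). -/
noncomputable def powEsymmIdeal (n k s : ℕ) : Ideal (MvPolynomial (Fin n) ℚ) :=
  Ideal.span ({g | ∃ i : Fin n, g = X i ^ k} ∪
    {g | ∃ j : ℕ, n + 1 ≤ j + s ∧ g = esymmOn n Finset.univ j})

/-- The ideal `J_n + ⟨e_n, …, e_{n-s+1}⟩` (the unit ideal if `s > n`). -/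
noncomputable def packedIdeal (n s : ℕ) : Ideal (MvPolynomial (Fin n) ℚ) :=
  Jn n ⊔ Ideal.span {g | ∃ j : ℕ, n + 1 ≤ j + s ∧ g = esymmOn n Finset.univ j}

lemma esymmOn_univ_eq_zero {n j : ℕ} (h : n < j) : esymmOn n Finset.univ j = 0 :=
  esymFun_eq_zero _ (by simpa using h)

lemma Ink_eq {n k : ℕ} (hkn : k ≤ n) : Ink n k = powEsymmIdeal n k k := by
  refine le_antisymm (Ideal.span_mono (Set.union_subset_union_right _ ?_)) (Ideal.span_le.2 ?_)
  · rintro _ ⟨j, h1, -, rfl⟩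
    exact ⟨j, by omega, rfl⟩
  · rintro _ (⟨i, rfl⟩ | ⟨j, h, rfl⟩)
    · exact Ideal.subset_span (Or.inl ⟨i, rfl⟩)
    · rcases le_or_gt j n with hj | hj
      · exact Ideal.subset_span (Or.inr ⟨j, by omega, hj, rfl⟩)
      · simp [esymmOn_univ_eq_zero hj]

lemma Jnk_eq {n k : ℕ} (hkn : k ≤ n) : Jnk n k = packedIdeal n k := by
  refine le_antisymm (sup_le_sup_left (Ideal.span_mono ?_) _)
    (sup_le le_sup_left (Ideal.span_le.2 ?_))
  · rintro _ ⟨j, h1, -, rfl⟩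
    exact ⟨j, by omega, rfl⟩
  · rintro _ ⟨j, h, rfl⟩
    rcases le_or_gt j n with hj | hj
    · exact Ideal.mem_sup_right (Ideal.subset_span ⟨j, by omega, hj, rfl⟩)
    · simp [esymmOn_univ_eq_zero hj]

lemma pow_mem_powEsymmIdeal {n k s : ℕ} (i : Fin n) : X i ^ k ∈ powEsymmIdeal n k s :=
  Ideal.subset_span (Or.inl ⟨i, rfl⟩)

lemma esymmOn_mem_powEsymmIdeal {n k s j : ℕ} (h : n + 1 ≤ j + s) :
    esymmOn n Finset.univ j ∈ powEsymmIdeal n k s :=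
  Ideal.subset_span (Or.inr ⟨j, h, rfl⟩)

lemma esymmOn_mem_packedIdeal {n s j : ℕ} (h : n + 1 ≤ j + s) :
    esymmOn n Finset.univ j ∈ packedIdeal n s :=
  Ideal.mem_sup_right (Ideal.subset_span ⟨j, h, rfl⟩)

/-! ### A spanning set of size `#{f : [n] → [k] | A ⊆ range f}` modulo `powEsymmIdeal n k #A` -/

lemma pow_mul_rename_esymmOn_mem {n k s : ℕ} (t m : ℕ) (hs : n + 1 ≤ m + s) (ht : n + 1 ≤ m + t) :
    X 0 ^ t * rename Fin.succ (esymmOn n Finset.univ m) ∈ powEsymmIdeal (n + 1) k s := by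
  induction t generalizing m with
  | zero => simp [esymmOn_univ_eq_zero (show n < m by omega)]
  | succ t ih =>
    have h := esymmOn_succ n m
    have : X 0 ^ (t + 1) * rename Fin.succ (esymmOn n Finset.univ m) =
        X 0 ^ t * esymmOn (n + 1) Finset.univ (m + 1) -
          X 0 ^ t * rename Fin.succ (esymmOn n Finset.univ (m + 1)) := by
      rw [h]; ring
    rw [this]
    exact sub_mem (Ideal.mul_mem_left _ _ (esymmOn_mem_powEsymmIdeal (by omega)))
      (ih (m + 1) (by omega) (by omega))

lemma exists_eq_rename_add {n : ℕ} (p : MvPolynomial (Fin (n + 1)) ℚ) :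
    ∃ p₀ p₁, p = rename Fin.succ p₀ + X 0 * p₁ := by
  induction p using MvPolynomial.induction_on with
  | C a => exact ⟨C a, 0, by simp⟩
  | add p q hp hq =>
    obtain ⟨p₀, p₁, rfl⟩ := hp
    obtain ⟨q₀, q₁, rfl⟩ := hq
    exact ⟨p₀ + q₀, p₁ + q₁, by rw [map_add]; ring⟩
  | mul_X p i hp =>
    obtain ⟨p₀, p₁, rfl⟩ := hp
    refine Fin.cases ?_ (fun j => ?_) i
    · exact ⟨0, rename Fin.succ p₀ + X 0 * p₁, by rw [map_zero]; ring⟩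
    · exact ⟨p₀ * X j, p₁ * X j.succ, by rw [map_mul, rename_X]; ring⟩

/-- If `s' = s - 1` when `t < s` and `s' = s` when `s ≤ t`, then multiplication by `x_0^t` maps
`powEsymmIdeal n k s'` into `powEsymmIdeal (n + 1) k s` up to multiples of `x_0^(t+1)`. -/
lemma pow_mul_rename_mem_sup {n k s s' t : ℕ} (h : s' + 1 = s ∨ s' = s ∧ s ≤ t)
    {q : MvPolynomial (Fin n) ℚ} (hq : q ∈ powEsymmIdeal n k s') :
    X 0 ^ t * rename Fin.succ q ∈
      powEsymmIdeal (n + 1) k s ⊔ Ideal.span {(X 0 : MvPolynomial (Fin (n + 1)) ℚ) ^ (t + 1)} := by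
  induction hq using Submodule.span_induction with
  | zero => simp
  | add x y _ _ hx hy => rw [map_add, mul_add]; exact add_mem hx hy
  | smul a x _ hx =>
    rw [smul_eq_mul, map_mul, mul_left_comm]
    exact Ideal.mul_mem_left _ _ hx
  | mem x hx =>
    rcases hx with ⟨i, rfl⟩ | ⟨j, hj, rfl⟩
    · rw [map_pow, rename_X]
      exact Ideal.mem_sup_left (Ideal.mul_mem_left _ _ (pow_mem_powEsymmIdeal _))
    rcases h with rfl | ⟨rfl, hst⟩
    · rcases j with _ | j
      · refine Ideal.mem_sup_left (Ideal.mul_mem_left _ _ ?_)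
        have := esymmOn_mem_powEsymmIdeal (n := n + 1) (k := k) (s := s' + 1) (j := 0) (by omega)
        simpa [esymmOn_eq, esymFun_zero] using this
      · have : X 0 ^ t * rename Fin.succ (esymmOn n Finset.univ (j + 1)) =
            X 0 ^ t * esymmOn (n + 1) Finset.univ (j + 1) -
              rename Fin.succ (esymmOn n Finset.univ j) * X 0 ^ (t + 1) := by
          rw [esymmOn_succ]; ring
        rw [this]
        exact sub_mem
          (Ideal.mem_sup_left (Ideal.mul_mem_left _ _ (esymmOn_mem_powEsymmIdeal (by omega))))
          (Ideal.mem_sup_right (Ideal.mul_mem_left _ _ (Ideal.mem_span_singleton_self _)))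
    · exact Ideal.mem_sup_left (pow_mul_rename_esymmOn_mem t j hj (by omega))

lemma exists_perm_lt_card_iff {k : ℕ} (A : Finset (Fin k)) :
    ∃ σ : Equiv.Perm (Fin k), ∀ v, (σ v : ℕ) < A.card ↔ v ∈ A := by
  classical
  have hA : A.card ≤ k := by simpa using A.card_le_univ
  have hcard : Fintype.card {v // v ∈ A} = Fintype.card {v : Fin k // (v : ℕ) < A.card} := by
    rw [Fintype.card_coe]
    refine (Fintype.card_of_bijective (f := fun a : Fin A.card =>
      (⟨⟨a, by omega⟩, a.2⟩ : {v : Fin k // (v : ℕ) < A.card})) ⟨?_, ?_⟩).symm.trans ?_ |>.symm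
    · intro a b h
      simpa [Fin.ext_iff] using h
    · rintro ⟨⟨v, hv⟩, hv'⟩
      exact ⟨⟨v, hv'⟩, rfl⟩
    · simp
  let e := Fintype.equivOfCardEq hcard
  refine ⟨e.extendSubtype, fun v => ⟨fun h => ?_, fun h => e.extendSubtype_mem v h⟩⟩
  by_contra hv
  exact e.extendSubtype_not_mem v hv h

theorem exists_spanning_powEsymmIdeal (n k : ℕ) (A : Finset (Fin k)) :
    ∃ b : (Fin n → Fin k) → MvPolynomial (Fin n) ℚ, ∀ p,
      ∃ q ∈ Submodule.span ℚ (b '' {f | ∀ v ∈ A, ∃ i, f i = v}),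
        p - q ∈ powEsymmIdeal n k A.card := by
  classical
  induction n generalizing A with
  | zero =>
    refine ⟨fun _ => 1, fun p => ?_⟩
    rcases A.eq_empty_or_nonempty with rfl | hA
    · refine ⟨p, ?_, by simp⟩
      rw [eq_C_of_isEmpty p, ← mul_one (C _), ← smul_eq_C_mul]
      exact Submodule.smul_mem _ _ (Submodule.subset_span ⟨Fin.elim0, by simp, rfl⟩)
    · refine ⟨0, zero_mem _, ?_⟩
      have := esymmOn_mem_powEsymmIdeal (n := 0) (k := k) (s := A.card) (j := 0)
        (by have := hA.card_pos; omega)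
      rw [esymmOn_eq, esymFun_zero] at this
      rw [(Ideal.eq_top_iff_one _).2 this]
      trivial
  | succ n ih =>
    choose b hb using ih
    obtain ⟨σ, hσ⟩ := exists_perm_lt_card_iff A
    let b' : (Fin (n + 1) → Fin k) → MvPolynomial (Fin (n + 1)) ℚ := fun f =>
      X 0 ^ (σ (f 0) : ℕ) * rename Fin.succ (b (A.erase (f 0)) (Fin.tail f))
    let M := Submodule.span ℚ (b' '' {f | ∀ v ∈ A, ∃ i, f i = v}) ⊔
      (powEsymmIdeal (n + 1) k A.card).restrictScalars ℚ
    have hI : ∀ p ∈ powEsymmIdeal (n + 1) k A.card, p ∈ M := fun p hp =>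
      Submodule.mem_sup_right hp
    have key : ∀ j t, k ≤ t + j → ∀ p, X 0 ^ t * p ∈ M := by
      intro j
      induction j with
      | zero =>
        intro t ht p
        obtain ⟨u, rfl⟩ := Nat.exists_eq_add_of_le (show k ≤ t from ht)
        refine hI _ (Ideal.mul_mem_right _ _ ?_)
        rw [pow_add]
        exact Ideal.mul_mem_right _ _ (pow_mem_powEsymmIdeal _)
      | succ j ihj =>
        intro t ht p
        rcases le_or_gt k t with hkt | hkt
        · exact ihj t (by omega) p
        obtain ⟨p₀, p₁, rfl⟩ := exists_eq_rename_add p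
        obtain ⟨v, hv⟩ := σ.surjective ⟨t, hkt⟩
        obtain ⟨q, hq, hpq⟩ := hb (A.erase v) p₀
        have hcase : (A.erase v).card + 1 = A.card ∨
            (A.erase v).card = A.card ∧ A.card ≤ t := by
          by_cases hvA : v ∈ A
          · exact Or.inl (Finset.card_erase_add_one hvA)
          · refine Or.inr ⟨by rw [Finset.erase_eq_of_notMem hvA], ?_⟩
            have := (hσ v).not.2 hvA
            rw [hv] at this
            simpa using this
        have h1 := pow_mul_rename_mem_sup (t := t) hcase hpq
        have h2 : X 0 ^ t * rename Fin.succ (p₀ - q) ∈ M := by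
          obtain ⟨y, hy, z, hz, hyz⟩ := Submodule.mem_sup.1 h1
          obtain ⟨w, rfl⟩ := Ideal.mem_span_singleton'.1 hz
          rw [← hyz, mul_comm w]
          exact add_mem (hI _ hy) (ihj (t + 1) (by omega) w)
        have h3 : X 0 ^ t * rename Fin.succ q ∈ M := by
          refine Submodule.mem_sup_left ?_
          clear h2 h1 hpq
          induction hq using Submodule.span_induction with
          | zero => simp
          | add x y _ _ hx hy => rw [map_add, mul_add]; exact add_mem hx hy
          | smul a x _ hx => rw [map_smul, mul_smul_comm]; exact Submodule.smul_mem _ _ hx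
          | mem x hx =>
            obtain ⟨f, hf, rfl⟩ := hx
            refine Submodule.subset_span ⟨Fin.cons v f, fun u hu => ?_, ?_⟩
            · by_cases huv : u = v
              · exact ⟨0, huv.symm⟩
              · obtain ⟨i, hi⟩ := hf u (Finset.mem_erase.2 ⟨huv, hu⟩)
                exact ⟨i.succ, hi⟩
            · simp [b', hv]
        have h4 := ihj (t + 1) (by omega) p₁
        have : X 0 ^ t * (rename Fin.succ p₀ + X 0 * p₁) =
            X 0 ^ t * rename Fin.succ (p₀ - q) + X 0 ^ t * rename Fin.succ q +
              X 0 ^ (t + 1) * p₁ := by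
          rw [map_sub]; ring
        rw [this]
        exact add_mem (add_mem h2 h3) h4
    refine ⟨b', fun p => ?_⟩
    have := key k 0 (by omega) p
    rw [pow_zero, one_mul] at this
    obtain ⟨y, hy, z, hz, rfl⟩ := Submodule.mem_sup.1 this
    exact ⟨y, hy, by simpa using hz⟩

/-! ### Orbit harmonics: top-degree components of polynomials vanishing on a finite set -/

/-- The polynomials of degree less than `d`. -/
noncomputable def lowDegree (n d : ℕ) : Submodule ℚ (MvPolynomial (Fin n) ℚ) :=
  Submodule.span ℚ {p | ∃ m < d, p.IsHomogeneous m}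

lemma mem_lowDegree {n m d : ℕ} (h : m < d) {p : MvPolynomial (Fin n) ℚ}
    (hp : p.IsHomogeneous m) : p ∈ lowDegree n d :=
  Submodule.subset_span ⟨m, h, hp⟩

lemma lowDegree_mono (n : ℕ) {a b : ℕ} (h : a ≤ b) : lowDegree n a ≤ lowDegree n b :=
  Submodule.span_mono fun _ ⟨m, hm, hp⟩ => ⟨m, by omega, hp⟩

lemma X_mul_mem_lowDegree {n d : ℕ} (i : Fin n) {p : MvPolynomial (Fin n) ℚ}
    (hp : p ∈ lowDegree n d) : X i * p ∈ lowDegree n (d + 1) := by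
  induction hp using Submodule.span_induction with
  | zero => simp
  | add x y _ _ hx hy => rw [mul_add]; exact add_mem hx hy
  | smul a x _ hx => rw [mul_smul_comm]; exact Submodule.smul_mem _ _ hx
  | mem x hx =>
    obtain ⟨m, hm, hx⟩ := hx
    exact mem_lowDegree (m := 1 + m) (by omega) ((isHomogeneous_X ℚ i).mul hx)

/-- Evaluation of polynomials at a family of points. -/
noncomputable def evalPts {n : ℕ} {ι : Type*} (pts : ι → Fin n → ℚ) :
    MvPolynomial (Fin n) ℚ →ₐ[ℚ] (ι → ℚ) :=
  aeval fun i a => pts a i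

lemma evalPts_apply {n : ℕ} {ι : Type*} (pts : ι → Fin n → ℚ) (p : MvPolynomial (Fin n) ℚ)
    (a : ι) : evalPts pts p a = eval (pts a) p := by
  induction p using MvPolynomial.induction_on with
  | C r => simp [evalPts]
  | add p q hp hq => simp [hp, hq]
  | mul_X p i hp => rw [map_mul, Pi.mul_apply, hp, map_mul]; simp [evalPts]

lemma homogeneousComponent_add_mul {n a : ℕ} (p : MvPolynomial (Fin n) ℚ)
    {q : MvPolynomial (Fin n) ℚ} (hq : q.IsHomogeneous a) (d : ℕ) :
    homogeneousComponent (d + a) (p * q) = homogeneousComponent d p * q := by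
  conv_lhs => rw [← sum_homogeneousComponent p, Finset.sum_mul, map_sum]
  have h (j : ℕ) : homogeneousComponent (d + a) (homogeneousComponent j p * q) =
      if d = j then homogeneousComponent j p * q else 0 := by
    have := homogeneousComponent_of_mem (m := d + a) (n := j + a)
      ((homogeneousComponent_isHomogeneous j p).mul hq)
    simpa using this
  simp only [h, Finset.sum_ite_eq, Finset.mem_range]
  split_ifs with hd
  · rfl
  · rw [homogeneousComponent_eq_zero _ _ (by omega), zero_mul]

lemma homogeneousComponent_mul_eq_zero {n a d : ℕ} (p : MvPolynomial (Fin n) ℚ)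
    {q : MvPolynomial (Fin n) ℚ} (hq : q.IsHomogeneous a) (hd : d < a) :
    homogeneousComponent d (p * q) = 0 := by
  rw [← sum_homogeneousComponent p, Finset.sum_mul, map_sum]
  refine Finset.sum_eq_zero fun j _ => ?_
  rw [homogeneousComponent_of_mem ((homogeneousComponent_isHomogeneous j p).mul hq),
    if_neg (by omega)]

/-- The ideal of polynomials each of whose homogeneous components agrees on the given points with
a polynomial of smaller degree. -/
noncomputable def topIdeal {n : ℕ} {ι : Type*} (pts : ι → Fin n → ℚ) :
    Ideal (MvPolynomial (Fin n) ℚ) where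
  carrier := {g | ∀ d, evalPts pts (homogeneousComponent d g) ∈
    (lowDegree n d).map (evalPts pts).toLinearMap}
  zero_mem' d := by simp
  add_mem' hf hg d := by rw [map_add, map_add]; exact add_mem (hf d) (hg d)
  smul_mem' c g hg := by
    rw [smul_eq_mul, mul_comm]
    induction c using MvPolynomial.induction_on with
    | C a =>
      intro d
      rw [mul_comm, homogeneousComponent_C_mul, ← smul_eq_C_mul, map_smul]
      exact Submodule.smul_mem _ _ (hg d)
    | add p q hp hq =>
      intro d
      rw [mul_add, map_add, map_add]
      exact add_mem (hp d) (hq d)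
    | mul_X p i hp =>
      intro d
      rw [← mul_assoc]
      rcases d with _ | d
      · rw [homogeneousComponent_mul_eq_zero _ (isHomogeneous_X ℚ i) one_pos, map_zero]
        exact zero_mem _
      · obtain ⟨f, hf, hfe⟩ := hp d
        refine ⟨X i * f, X_mul_mem_lowDegree i hf, ?_⟩
        rw [AlgHom.toLinearMap_apply] at hfe ⊢
        rw [homogeneousComponent_add_mul _ (isHomogeneous_X ℚ i), map_mul, map_mul, ← hfe, mul_comm]

lemma mem_topIdeal {n : ℕ} {ι : Type*} {pts : ι → Fin n → ℚ} {f g : MvPolynomial (Fin n) ℚ}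
    {d : ℕ} (hg : g.IsHomogeneous d) (hfg : f - g ∈ lowDegree n d)
    (hf : ∀ a, eval (pts a) f = 0) : g ∈ topIdeal pts := by
  classical
  intro m
  rw [homogeneousComponent_of_mem hg]
  split_ifs with h
  · subst h
    refine ⟨-(f - g), neg_mem hfg, ?_⟩
    have : evalPts pts f = 0 := funext fun a => by rw [evalPts_apply, hf, Pi.zero_apply]
    simp [this]
  · simp

lemma evalPts_surjective {n : ℕ} {ι : Type*} [Finite ι] {pts : ι → Fin n → ℚ}
    (hpts : Function.Injective pts) : Function.Surjective (evalPts pts) := by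
  classical
  have := Fintype.ofFinite ι
  have h (a b : ι) : ∃ p, a ≠ b → eval (pts a) p ≠ 0 ∧ eval (pts b) p = 0 := by
    by_cases hab : a = b
    · exact ⟨0, fun h => (h hab).elim⟩
    · obtain ⟨i, hi⟩ := Function.ne_iff.1 (hpts.ne hab)
      exact ⟨X i - C (pts b i), fun _ => by simpa [sub_eq_zero] using hi⟩
  choose p hp using h
  let q (a : ι) := ∏ b ∈ Finset.univ.erase a, p a b
  have hq (a : ι) : eval (pts a) (q a) ≠ 0 := by
    rw [map_prod, Finset.prod_ne_zero_iff]
    intro b hb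
    exact (hp a b (Finset.ne_of_mem_erase hb).symm).1
  have hq' (a b : ι) (hab : b ≠ a) : eval (pts b) (q a) = 0 := by
    rw [map_prod]
    exact Finset.prod_eq_zero (Finset.mem_erase.2 ⟨hab, Finset.mem_univ b⟩) (hp a b hab.symm).2
  intro y
  refine ⟨∑ a, C (y a / eval (pts a) (q a)) * q a, funext fun b => ?_⟩
  rw [evalPts_apply, map_sum, Finset.sum_eq_single b]
  · simp [hq b]
  · intro a _ hab
    rw [map_mul, hq' a b hab.symm, mul_zero]
  · simp

theorem card_le_finrank_quotient {n : ℕ} {ι : Type*} [Fintype ι] {pts : ι → Fin n → ℚ}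
    (hpts : Function.Injective pts) {J : Ideal (MvPolynomial (Fin n) ℚ)} (hJ : J ≤ topIdeal pts)
    [Module.Finite ℚ (MvPolynomial (Fin n) ℚ ⧸ J)] :
    Fintype.card ι ≤ Module.finrank ℚ (MvPolynomial (Fin n) ℚ ⧸ J) := by
  classical
  let mon : (Fin n →₀ ℕ) → MvPolynomial (Fin n) ℚ := fun m => monomial m 1
  let mk := (Ideal.Quotient.mkₐ ℚ J).toLinearMap
  have hmon : Submodule.span ℚ (Set.range mon) = ⊤ := by
    have := (basisMonomials (Fin n) ℚ).span_eq
    rwa [coe_basisMonomials] at this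
  obtain ⟨κ, a, -, hspan, hli⟩ := exists_linearIndependent' ℚ (mk ∘ mon)
  have : Finite κ := hli.finite
  have := Fintype.ofFinite κ
  let B := Submodule.span ℚ (Set.range (mon ∘ a))
  have hmk (p) : ∃ q ∈ B, p - q ∈ J := by
    have hp : mk p ∈ Submodule.span ℚ (Set.range (mk ∘ mon ∘ a)) := by
      rw [← Function.comp_assoc, hspan, Set.range_comp, ← Submodule.map_span, hmon]
      exact Submodule.mem_map_of_mem trivial
    rw [Set.range_comp, ← Submodule.map_span] at hp
    obtain ⟨q, hq, hqp⟩ := hp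
    exact ⟨q, hq, Ideal.Quotient.eq.1 hqp.symm⟩
  have hcomp (d : ℕ) (q) (hq : q ∈ B) : homogeneousComponent d q ∈ B := by
    induction hq using Submodule.span_induction with
    | zero => simp
    | add x y _ _ hx hy => rw [map_add]; exact add_mem hx hy
    | smul c x _ hx => rw [map_smul]; exact Submodule.smul_mem _ _ hx
    | mem x hx =>
      obtain ⟨c, rfl⟩ := hx
      have := homogeneousComponent_of_mem (m := d) (isHomogeneous_monomial (1 : ℚ) (rfl : (a c).degree = _))
      simp only [Function.comp_apply, mon]
      rw [this]
      split_ifs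
      · exact Submodule.subset_span ⟨c, rfl⟩
      · exact zero_mem _
  have key (d : ℕ) : ∀ p : MvPolynomial (Fin n) ℚ, p.IsHomogeneous d →
      evalPts pts p ∈ B.map (evalPts pts).toLinearMap := by
    induction d using Nat.strong_induction_on with
    | _ d ih =>
      intro p hp
      obtain ⟨q, hq, hpq⟩ := hmk p
      have h1 : (lowDegree n d).map (evalPts pts).toLinearMap ≤
          B.map (evalPts pts).toLinearMap := by
        rw [lowDegree, Submodule.map_span, Submodule.span_le]
        rintro _ ⟨r, ⟨m, hm, hr⟩, rfl⟩
        exact ih m hm r hr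
      have h2 := h1 (hJ hpq d)
      have h3 : evalPts pts (homogeneousComponent d q) ∈ B.map (evalPts pts).toLinearMap :=
        ⟨_, hcomp d q hq, rfl⟩
      rw [map_sub, homogeneousComponent_eq_self hp, map_sub] at h2
      simpa using add_mem h2 h3
  have htop : B.map (evalPts pts).toLinearMap = ⊤ := by
    rw [eq_top_iff]
    intro y _
    obtain ⟨p, rfl⟩ := evalPts_surjective hpts y
    rw [← sum_homogeneousComponent p, map_sum]
    exact Submodule.sum_mem _ fun d _ => key d _ (homogeneousComponent_isHomogeneous d p)
  rw [Submodule.map_span, ← Set.range_comp] at htop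
  have h1 := finrank_range_le_card (R := ℚ) ((evalPts pts).toLinearMap ∘ mon ∘ a)
  rw [Set.finrank, htop, finrank_top, Module.finrank_fintype_fun_eq_card] at h1
  exact h1.trans hli.fintype_card_le_finrank

/-! ### The ideal `packedIdeal n k` is contained in the top-degree ideal of packed words -/

/-- The coefficient sequence of `F(t) / (1 + α t)`, where `f` is that of `F(t)`. -/
def divSeq {R : Type*} [Ring R] (α : R) (f : ℕ → R) : ℕ → R
  | 0 => f 0
  | m + 1 => f (m + 1) - α * divSeq α f m

/-- The coefficient sequence of `F(t) / ((1 + 0 t) (1 + t) ⋯ (1 + (r - 1) t))`. -/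
def divSeqIter {R : Type*} [Ring R] (f : ℕ → R) : ℕ → ℕ → R
  | 0 => f
  | r + 1 => divSeq (r : R) (divSeqIter f r)

lemma map_divSeq {R S : Type*} [Ring R] [Ring S] (φ : R →+* S) (α : R) (f : ℕ → R) (m : ℕ) :
    φ (divSeq α f m) = divSeq (φ α) (fun m => φ (f m)) m := by
  induction m with
  | zero => rfl
  | succ m ih => simp [divSeq, ih]

lemma map_divSeqIter {R S : Type*} [Ring R] [Ring S] (φ : R →+* S) (f : ℕ → R) (r m : ℕ) :
    φ (divSeqIter f r m) = divSeqIter (fun m => φ (f m)) r m := by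
  induction r generalizing m with
  | zero => rfl
  | succ r ih =>
    rw [divSeqIter, map_divSeq, map_natCast, divSeqIter]
    congr 1
    exact funext ih

lemma divSeqIter_sub_mem {n : ℕ} {e : ℕ → MvPolynomial (Fin n) ℚ}
    (he : ∀ m, (e m).IsHomogeneous m) (r m : ℕ) : divSeqIter e r m - e m ∈ lowDegree n m := by
  induction r generalizing m with
  | zero => simp [divSeqIter]
  | succ r ih =>
    rw [divSeqIter]
    induction m with
    | zero => exact ih 0
    | succ m ihm =>
      have h : divSeq (r : MvPolynomial (Fin n) ℚ) (divSeqIter e r) m ∈ lowDegree n (m + 1) := by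
        simpa using add_mem (lowDegree_mono n m.le_succ ihm) (mem_lowDegree m.lt_succ_self (he m))
      rw [divSeq, sub_right_comm, ← nsmul_eq_mul]
      exact sub_mem (ih (m + 1)) (nsmul_mem h r)

lemma divSeq_esymFun {ι : Type*} [DecidableEq ι] (y : ι → ℚ) {s : Finset ι} {i : ι} (hi : i ∈ s) :
    divSeq (y i) (esymFun y s) = esymFun y (s.erase i) := by
  funext m
  induction m with
  | zero => simp [divSeq, esymFun_zero]
  | succ m ih =>
    rw [divSeq, ih]
    conv_lhs => rw [← Finset.insert_erase hi]
    rw [esymFun_insert _ (Finset.notMem_erase i s), Finset.erase_insert (Finset.notMem_erase i s)]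
    ring

lemma exists_divSeqIter_esymFun {ι : Type*} (y : ι → ℚ) (s : Finset ι) (r : ℕ)
    (h : ∀ c < r, ∃ i ∈ s, y i = (c : ℕ)) :
    ∃ s' ⊆ s, s'.card + r = s.card ∧ (∀ i ∈ s, (∀ c < r, y i ≠ (c : ℕ)) → i ∈ s') ∧
      divSeqIter (esymFun y s) r = esymFun y s' := by
  classical
  induction r with
  | zero => exact ⟨s, subset_rfl, rfl, fun i hi _ => hi, rfl⟩
  | succ r ih =>
    obtain ⟨s', hs, hcard, hmem, heq⟩ := ih fun c hc => h c (by omega)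
    obtain ⟨i, hi, hir⟩ := h r (by omega)
    have his' : i ∈ s' := hmem i hi fun c hc => by
      rw [hir]; exact_mod_cast (show r ≠ c by omega)
    refine ⟨s'.erase i, (Finset.erase_subset _ _).trans hs, ?_, fun j hj hjc => ?_, ?_⟩
    · have := Finset.card_erase_add_one his'
      omega
    · refine Finset.mem_erase.2 ⟨?_, hmem j hj fun c hc => hjc c (by omega)⟩
      rintro rfl
      exact hjc r (by omega) hir
    · rw [divSeqIter, heq, ← hir, divSeq_esymFun y his']

lemma divSeqIter_esymFun_eq_zero {ι : Type*} {y : ι → ℚ} {s : Finset ι} {r m : ℕ}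
    (h : ∀ c < r, ∃ i ∈ s, y i = (c : ℕ)) (hm : s.card < m + r) :
    divSeqIter (esymFun y s) r m = 0 := by
  obtain ⟨s', -, hcard, -, heq⟩ := exists_divSeqIter_esymFun y s r h
  rw [heq, esymFun_eq_zero _ (by omega)]

lemma eval_divSeqIter_esymmOn {n : ℕ} (y : Fin n → ℚ) (s : Finset (Fin n)) (r m : ℕ) :
    eval y (divSeqIter (esymmOn n s) r m) = divSeqIter (esymFun y s) r m := by
  rw [map_divSeqIter]
  congr 1
  funext m
  rw [esymmOn_eq, map_esymFun]
  simp

/-- Words whose set of letters is an initial segment of `ℕ` containing `0, …, k - 1`. -/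
def InitialWord (n k : ℕ) (w : Fin n → Fin n) : Prop :=
  (∀ p, ∀ c < (w p : ℕ), ∃ q, (w q : ℕ) = c) ∧ ∀ c < k, ∃ q, (w q : ℕ) = c

/-- The points of `ℚ^n` given by the words in `InitialWord n k`. -/
def wordPts (n k : ℕ) (w : {w : Fin n → Fin n // InitialWord n k w}) (p : Fin n) : ℚ :=
  (w.1 p : ℕ)

lemma wordPts_injective (n k : ℕ) : Function.Injective (wordPts n k) := fun w w' h =>
  Subtype.ext <| funext fun p => Fin.ext <| by simpa [wordPts] using congrFun h p

lemma prod_mul_sub_mem {n m : ℕ} {f g : MvPolynomial (Fin n) ℚ} (i : Fin n)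
    (hg : g.IsHomogeneous m) (hfg : f - g ∈ lowDegree n m) (r : ℕ) :
    (∏ c ∈ Finset.range r, (X i - C (c : ℚ))) * f - X i ^ r * g ∈ lowDegree n (r + m) := by
  induction r with
  | zero => simpa using hfg
  | succ r ih =>
    set F := (∏ c ∈ Finset.range r, (X i - C (c : ℚ))) * f with hF
    have hG : (X i ^ r * g).IsHomogeneous (r + m) := (isHomogeneous_X_pow i r).mul hg
    have hF' : F ∈ lowDegree n (r + m + 1) := by
      simpa using add_mem (lowDegree_mono n (Nat.le_succ _) ih)
        (mem_lowDegree (Nat.lt_succ_self _) hG)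
    have : (∏ c ∈ Finset.range (r + 1), (X i - C (c : ℚ))) * f - X i ^ (r + 1) * g =
        X i * (F - X i ^ r * g) - (r : ℚ) • F := by
      rw [Finset.prod_range_succ, hF, smul_eq_C_mul]; ring
    rw [this, show r + 1 + m = r + m + 1 by omega]
    exact sub_mem (X_mul_mem_lowDegree i ih) (Submodule.smul_mem _ _ hF')

lemma pow_mul_esymmOn_mem_topIdeal {n k r : ℕ} (i : Fin n) (hr : 1 ≤ r) (hrn : r ≤ n) :
    X i ^ r * esymmOn n {i}ᶜ (n - r) ∈ topIdeal (wordPts n k) := by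
  have hhom := isHomogeneous_esymmOn n {i}ᶜ
  refine mem_topIdeal (f := (∏ c ∈ Finset.range r, (X i - C (c : ℚ))) *
    divSeqIter (esymmOn n {i}ᶜ) r (n - r)) ((isHomogeneous_X_pow i r).mul (hhom _))
    (prod_mul_sub_mem i (hhom _) (divSeqIter_sub_mem hhom _ _) _) fun w => ?_
  rw [map_mul, eval_divSeqIter_esymmOn]
  rcases lt_or_ge (w.1 i : ℕ) r with h | h
  · rw [map_prod, Finset.prod_eq_zero (Finset.mem_range.2 h) (by simp [wordPts]), zero_mul]
  · rw [divSeqIter_esymFun_eq_zero, mul_zero]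
    · intro c hc
      obtain ⟨q, hq⟩ := w.2.1 i c (by omega)
      refine ⟨q, ?_, by simp [wordPts, hq]⟩
      rw [Finset.mem_compl, Finset.mem_singleton]
      rintro rfl
      omega
    · rw [Finset.card_compl, Fintype.card_fin, Finset.card_singleton]
      omega

theorem packedIdeal_le_topIdeal (n k : ℕ) : packedIdeal n k ≤ topIdeal (wordPts n k) := by
  refine sup_le (Ideal.span_le.2 ?_) (Ideal.span_le.2 ?_)
  · rintro _ ⟨i, r, d, hr, hrd, rfl⟩
    obtain ⟨u, rfl⟩ := Nat.exists_eq_add_of_le hrd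
    rcases le_or_gt r n with hrn | hrn
    · rw [pow_add, mul_right_comm]
      exact Ideal.mul_mem_right _ _ (pow_mul_esymmOn_mem_topIdeal i hr hrn)
    · have h := pow_mul_esymmOn_mem_topIdeal (k := k) i (Fin.pos i) le_rfl
      rw [Nat.sub_self, esymmOn_eq, esymFun_zero, mul_one] at h
      refine Ideal.mul_mem_right _ _ ?_
      rw [show r + u = n + (r + u - n) by omega, pow_add]
      exact Ideal.mul_mem_right _ _ h
  · rintro _ ⟨j, hj, rfl⟩
    have hhom := isHomogeneous_esymmOn n Finset.univ
    refine mem_topIdeal (hhom j) (divSeqIter_sub_mem hhom k j) fun w => ?_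
    rw [eval_divSeqIter_esymmOn, divSeqIter_esymFun_eq_zero]
    · intro c hc
      obtain ⟨q, hq⟩ := w.2.2 c hc
      exact ⟨q, Finset.mem_univ q, by simp [wordPts, hq]⟩
    · simpa using hj

/-! ### Dimension count -/

lemma exists_linearMap_comp_eq {K V W U : Type*} [Field K] [AddCommGroup V] [Module K V]
    [AddCommGroup W] [Module K W] [AddCommGroup U] [Module K U] {q : V →ₗ[K] W}
    (hq : Function.Surjective q) {f : V →ₗ[K] U} (h : ∀ v, q v = 0 → f v = 0) :
    ∃ g : W →ₗ[K] U, ∀ v, g (q v) = f v := by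
  obtain ⟨s, hs⟩ := q.exists_rightInverse_of_surjective (LinearMap.range_eq_top.2 hq)
  refine ⟨f ∘ₗ s, fun v => ?_⟩
  have hqs : q (s (q v)) = q v := LinearMap.congr_fun hs (q v)
  exact sub_eq_zero.1 (by
    rw [LinearMap.comp_apply, ← map_sub]
    exact h _ (by rw [map_sub, hqs, sub_self]))

/-- The quotient map `ℚ[x_1, …, x_n] → ℚ[x_1, …, x_n]/I` as a `ℚ`-linear map. -/
noncomputable def quotMap {n : ℕ} (I : Ideal (MvPolynomial (Fin n) ℚ)) :
    MvPolynomial (Fin n) ℚ →ₗ[ℚ] MvPolynomial (Fin n) ℚ ⧸ I :=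
  (Ideal.Quotient.mkₐ ℚ I).toLinearMap

lemma quotMap_apply {n : ℕ} (I : Ideal (MvPolynomial (Fin n) ℚ)) (f) :
    quotMap I f = Ideal.Quotient.mk I f := rfl

lemma quotMap_eq_zero {n : ℕ} {I : Ideal (MvPolynomial (Fin n) ℚ)} {f} :
    quotMap I f = 0 ↔ f ∈ I := Ideal.Quotient.eq_zero_iff_mem

lemma quotMap_eq {n : ℕ} {I : Ideal (MvPolynomial (Fin n) ℚ)} {f g} :
    quotMap I f = quotMap I g ↔ f - g ∈ I := Ideal.Quotient.eq

lemma quotMap_surjective {n : ℕ} (I : Ideal (MvPolynomial (Fin n) ℚ)) :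
    Function.Surjective (quotMap I) := Ideal.Quotient.mk_surjective

lemma finite_and_finrank_powEsymmIdeal_le (n k : ℕ) (A : Finset (Fin k)) :
    Module.Finite ℚ (MvPolynomial (Fin n) ℚ ⧸ powEsymmIdeal n k A.card) ∧
      Module.finrank ℚ (MvPolynomial (Fin n) ℚ ⧸ powEsymmIdeal n k A.card) ≤
        Nat.card {f : Fin n → Fin k // ∀ v ∈ A, ∃ i, f i = v} := by
  classical
  obtain ⟨b, hb⟩ := exists_spanning_powEsymmIdeal n k A
  let Q := quotMap (powEsymmIdeal n k A.card)
  let c : {f : Fin n → Fin k // ∀ v ∈ A, ∃ i, f i = v} →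
      MvPolynomial (Fin n) ℚ ⧸ powEsymmIdeal n k A.card := fun f => Q (b f)
  have hc : Submodule.span ℚ (Set.range c) = ⊤ := by
    rw [eq_top_iff]
    intro y _
    obtain ⟨p, rfl⟩ := quotMap_surjective _ y
    obtain ⟨q, hq, hpq⟩ := hb p
    have : Set.range c = Q '' (b '' {f | ∀ v ∈ A, ∃ i, f i = v}) := by
      ext z
      simp [c]
    rw [this, ← Submodule.map_span, quotMap_eq.2 hpq]
    exact Submodule.mem_map_of_mem hq
  have hfin : Module.Finite ℚ (MvPolynomial (Fin n) ℚ ⧸ powEsymmIdeal n k A.card) :=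
    ⟨⟨(Set.finite_range c).toFinset, by simpa using hc⟩⟩
  refine ⟨hfin, ?_⟩
  have := finrank_range_le_card (R := ℚ) c
  rwa [Set.finrank, hc, finrank_top, ← Nat.card_eq_fintype_card] at this

instance finite_quotient_powEsymmIdeal (n k : ℕ) :
    Module.Finite ℚ (MvPolynomial (Fin n) ℚ ⧸ powEsymmIdeal n k k) := by
  have := (finite_and_finrank_powEsymmIdeal_le n k Finset.univ).1
  rwa [Finset.card_univ, Fintype.card_fin] at this

lemma finrank_powEsymmIdeal_le (n k : ℕ) :
    Module.finrank ℚ (MvPolynomial (Fin n) ℚ ⧸ powEsymmIdeal n k k) ≤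
      Nat.card {f : Fin n → Fin k // Function.Surjective f} := by
  have := (finite_and_finrank_powEsymmIdeal_le n k Finset.univ).2
  rw [Finset.card_univ, Fintype.card_fin] at this
  simp only [Finset.mem_univ, true_imp_iff] at this
  exact this

instance finite_quotient_packedIdeal (n s : ℕ) :
    Module.Finite ℚ (MvPolynomial (Fin n) ℚ ⧸ packedIdeal n s) := by
  have h : powEsymmIdeal n n 0 ≤ packedIdeal n s := by
    refine Ideal.span_le.2 ?_
    rintro _ (⟨i, rfl⟩ | ⟨j, hj, rfl⟩)
    · exact Ideal.mem_sup_left (Ideal.subset_span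
        ⟨i, n, n, Fin.pos i, le_rfl, by rw [Nat.sub_self, esymmOn_eq, esymFun_zero, mul_one]⟩)
    · simp [esymmOn_univ_eq_zero (show n < j by omega)]
  have := (finite_and_finrank_powEsymmIdeal_le n n ∅).1
  rw [Finset.card_empty] at this
  exact Module.Finite.of_surjective (Ideal.Quotient.factorₐ ℚ h).toLinearMap
    (Ideal.Quotient.factor_surjective h)

lemma card_surjective_add_card_initialWord_le {n k : ℕ} (hkn : k ≤ n) :
    Nat.card {f : Fin n → Fin k // Function.Surjective f} +
      Nat.card {w : Fin n → Fin n // InitialWord n (k + 1) w} ≤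
        Nat.card {w : Fin n → Fin n // InitialWord n k w} := by
  rw [← Nat.card_sum]
  refine Nat.card_le_card_of_injective (Sum.elim
    (fun f => ⟨fun p => Fin.castLE hkn (f.1 p), fun p c hc => ?_, fun c hc => ?_⟩)
    (fun w => ⟨w.1, w.2.1, fun c hc => w.2.2 c (by omega)⟩)) ?_
  · obtain ⟨q, hq⟩ := f.2 ⟨c, lt_trans hc (f.1 p).2⟩
    exact ⟨q, by simp [hq]⟩
  · obtain ⟨q, hq⟩ := f.2 ⟨c, hc⟩
    exact ⟨q, by simp [hq]⟩
  · refine Function.Injective.sumElim (fun f g h => ?_) (fun w w' h => ?_) fun f w h => ?_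
    · refine Subtype.ext (funext fun p => ?_)
      exact Fin.castLE_injective hkn (congrFun (congrArg Subtype.val h) p)
    · exact Subtype.ext (congrArg (fun x : {w // InitialWord n k w} => x.1) h)
    · obtain ⟨q, hq⟩ := w.2.2 k k.lt_succ_self
      have h1 := congrArg Fin.val (congrFun (congrArg Subtype.val h) q)
      simp only [Fin.val_castLE] at h1
      have := (f.1 q).2
      omega

lemma esymmOn_univ_succ {n : ℕ} (i : Fin n) (a : ℕ) :
    esymmOn n Finset.univ (a + 1) = esymmOn n {i}ᶜ (a + 1) + X i * esymmOn n {i}ᶜ a := by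
  classical
  rw [← Finset.insert_compl_self i, esymmOn_eq, esymFun_insert _ (by simp)]
  rfl

lemma esymmOn_mul_mem_packedIdeal {n k : ℕ} (hk : 1 ≤ k) (hkn : k ≤ n)
    {h : MvPolynomial (Fin n) ℚ} (hh : h ∈ powEsymmIdeal n k k) :
    esymmOn n Finset.univ (n - k) * h ∈ packedIdeal n k := by
  induction hh using Submodule.span_induction with
  | zero => simp
  | add x y _ _ hx hy => rw [mul_add]; exact add_mem hx hy
  | smul a x _ hx => rw [smul_eq_mul, mul_left_comm]; exact Ideal.mul_mem_left _ _ hx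
  | mem x hx =>
    rcases hx with ⟨i, rfl⟩ | ⟨j, hj, rfl⟩
    · have hJ {r : ℕ} (hr : 1 ≤ r) : X i ^ r * esymmOn n {i}ᶜ (n - r) ∈ packedIdeal n k :=
        Ideal.mem_sup_left (Ideal.subset_span ⟨i, r, r, hr, le_rfl, rfl⟩)
      rcases hkn.eq_or_lt with rfl | hlt
      · have := hJ hk
        rw [Nat.sub_self, esymmOn_eq, esymFun_zero] at this ⊢
        rwa [one_mul, ← mul_one (X i ^ _)]
      · have h1 := hJ hk
        have h2 := hJ (r := k + 1) (by omega)
        obtain ⟨a, ha⟩ := Nat.exists_eq_add_of_lt hlt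
        rw [show n - k = a + 1 by omega] at h1 ⊢
        rw [show n - (k + 1) = a by omega] at h2
        rw [esymmOn_univ_succ i]
        convert add_mem h1 h2 using 1
        ring
    · exact Ideal.mul_mem_left _ _ (esymmOn_mem_packedIdeal hj)

lemma packedIdeal_le_succ (n k : ℕ) : packedIdeal n k ≤ packedIdeal n (k + 1) :=
  sup_le_sup_left (Ideal.span_mono (by rintro _ ⟨j, hj, rfl⟩; exact ⟨j, by omega, rfl⟩)) _

lemma packedIdeal_mono (n : ℕ) : Monotone (packedIdeal n) :=
  monotone_nat_of_le_succ (packedIdeal_le_succ n)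

lemma exists_sub_mul_mem_packedIdeal {n k : ℕ} {f : MvPolynomial (Fin n) ℚ}
    (hf : f ∈ packedIdeal n (k + 1)) :
    ∃ h, f - esymmOn n Finset.univ (n - k) * h ∈ packedIdeal n k := by
  have hle : packedIdeal n (k + 1) ≤
      packedIdeal n k ⊔ Ideal.span {esymmOn n Finset.univ (n - k)} := by
    refine sup_le (le_sup_left.trans le_sup_left) (Ideal.span_le.2 ?_)
    rintro _ ⟨j, hj, rfl⟩
    rcases le_or_gt (n + 1) (j + k) with h | h
    · exact Ideal.mem_sup_left (esymmOn_mem_packedIdeal h)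
    · rw [show n - k = j by omega]
      exact Ideal.mem_sup_right (Ideal.mem_span_singleton_self _)
  obtain ⟨y, hy, z, hz, rfl⟩ := Submodule.mem_sup.1 (hle hf)
  obtain ⟨h, rfl⟩ := Ideal.mem_span_singleton'.1 hz
  exact ⟨h, by rwa [mul_comm, add_sub_cancel_right]⟩

lemma exists_mul_esymmOn_linearMap {n k : ℕ} (hk : 1 ≤ k) (hkn : k ≤ n) :
    ∃ μ : (MvPolynomial (Fin n) ℚ ⧸ powEsymmIdeal n k k) →ₗ[ℚ]
        (MvPolynomial (Fin n) ℚ ⧸ packedIdeal n k),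
      ∀ h, μ (quotMap _ h) = quotMap _ (esymmOn n Finset.univ (n - k) * h) :=
  exists_linearMap_comp_eq (quotMap_surjective _)
    (f := quotMap (packedIdeal n k) ∘ₗ LinearMap.mulLeft ℚ (esymmOn n Finset.univ (n - k)))
    fun _ hh => quotMap_eq_zero.2 (esymmOn_mul_mem_packedIdeal hk hkn (quotMap_eq_zero.1 hh))

lemma finrank_quotient_packedIdeal_add_ker {n k : ℕ} (hkn : k ≤ n)
    {μ : (MvPolynomial (Fin n) ℚ ⧸ powEsymmIdeal n k k) →ₗ[ℚ]
      (MvPolynomial (Fin n) ℚ ⧸ packedIdeal n k)}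
    (hμ : ∀ h, μ (quotMap _ h) = quotMap _ (esymmOn n Finset.univ (n - k) * h)) :
    Module.finrank ℚ (MvPolynomial (Fin n) ℚ ⧸ packedIdeal n k) +
        Module.finrank ℚ (LinearMap.ker μ) =
      Module.finrank ℚ (MvPolynomial (Fin n) ℚ ⧸ packedIdeal n (k + 1)) +
        Module.finrank ℚ (MvPolynomial (Fin n) ℚ ⧸ powEsymmIdeal n k k) := by
  let φ := (Ideal.Quotient.factorₐ ℚ (packedIdeal_le_succ n k)).toLinearMap
  have hφ (f) : φ (quotMap _ f) = quotMap _ f := rfl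
  have hsurj : LinearMap.range φ = ⊤ :=
    LinearMap.range_eq_top.2 (Ideal.Quotient.factor_surjective (packedIdeal_le_succ n k))
  have hker : LinearMap.ker φ = LinearMap.range μ := by
    ext y
    obtain ⟨f, rfl⟩ := quotMap_surjective _ y
    rw [LinearMap.mem_ker, hφ, quotMap_eq_zero, LinearMap.mem_range]
    constructor
    · intro hf
      obtain ⟨h, hh⟩ := exists_sub_mul_mem_packedIdeal hf
      exact ⟨quotMap _ h, by rw [hμ, quotMap_eq.2 hh]⟩
    · rintro ⟨y, hy⟩
      obtain ⟨h, rfl⟩ := quotMap_surjective _ y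
      rw [hμ, quotMap_eq] at hy
      rw [← neg_mem_iff, ← add_mem_cancel_left (x := esymmOn n Finset.univ (n - k) * h),
        ← sub_eq_add_neg]
      · exact packedIdeal_le_succ n k hy
      · exact Ideal.mul_mem_right _ _ (esymmOn_mem_packedIdeal (by omega))
  have h1 := φ.finrank_range_add_finrank_ker
  have h2 := μ.finrank_range_add_finrank_ker
  rw [hsurj, finrank_top, hker] at h1
  omega

lemma card_initialWord_le_finrank (n k : ℕ) :
    Nat.card {w : Fin n → Fin n // InitialWord n k w} ≤
      Module.finrank ℚ (MvPolynomial (Fin n) ℚ ⧸ packedIdeal n k) := by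
  classical
  rw [Nat.card_eq_fintype_card]
  exact card_le_finrank_quotient (wordPts_injective n k) (packedIdeal_le_topIdeal n k)

lemma finrank_quotient_packedIdeal_le {n k j : ℕ} (hk : 1 ≤ k) (hj : k + j = n + 1) :
    Module.finrank ℚ (MvPolynomial (Fin n) ℚ ⧸ packedIdeal n k) ≤
      Nat.card {w : Fin n → Fin n // InitialWord n k w} := by
  induction j generalizing k with
  | zero =>
    have : packedIdeal n k = ⊤ := by
      rw [Ideal.eq_top_iff_one, ← esymFun_zero (X : Fin n → MvPolynomial (Fin n) ℚ) Finset.univ]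
      exact esymmOn_mem_packedIdeal (by omega)
    have : Subsingleton (MvPolynomial (Fin n) ℚ ⧸ packedIdeal n k) :=
      Ideal.Quotient.subsingleton_iff.2 this
    rw [Module.finrank_zero_of_subsingleton]
    exact Nat.zero_le _
  | succ j ih =>
    have hkn : k ≤ n := by omega
    obtain ⟨μ, hμ⟩ := exists_mul_esymmOn_linearMap hk hkn
    have h1 := finrank_quotient_packedIdeal_add_ker hkn hμ
    have h2 := finrank_powEsymmIdeal_le n k
    have h3 := card_surjective_add_card_initialWord_le hkn
    have h4 := ih (k := k + 1) (by omega) (by omega)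
    omega

theorem mem_powEsymmIdeal_of_mul_mem {n k : ℕ} (hk : 1 ≤ k) (hkn : k ≤ n)
    {h : MvPolynomial (Fin n) ℚ} (hh : esymmOn n Finset.univ (n - k) * h ∈ packedIdeal n k) :
    h ∈ powEsymmIdeal n k k := by
  obtain ⟨μ, hμ⟩ := exists_mul_esymmOn_linearMap hk hkn
  have h1 := finrank_quotient_packedIdeal_add_ker hkn hμ
  have h2 := finrank_powEsymmIdeal_le n k
  have h3 := card_surjective_add_card_initialWord_le hkn
  have h4 := finrank_quotient_packedIdeal_le (n := n) (k := k + 1) (j := n - k)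
    (by omega) (by omega)
  have h5 := card_initialWord_le_finrank n k
  have hker : LinearMap.ker μ = ⊥ := Submodule.finrank_eq_zero.1 (by omega)
  rw [← quotMap_eq_zero, ← Submodule.mem_bot ℚ, ← hker, LinearMap.mem_ker, hμ]
  exact quotMap_eq_zero.2 hh

/-! ### The equivariant splitting -/

lemma rename_mem_powEsymmIdeal {n k s : ℕ} (σ : Equiv.Perm (Fin n)) {f : MvPolynomial (Fin n) ℚ}
    (hf : f ∈ powEsymmIdeal n k s) : rename σ f ∈ powEsymmIdeal n k s := by
  suffices powEsymmIdeal n k s ≤ (powEsymmIdeal n k s).comap (rename σ) from this hf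
  refine Ideal.span_le.2 ?_
  rintro _ (⟨i, rfl⟩ | ⟨j, hj, rfl⟩)
  · simpa using pow_mem_powEsymmIdeal (σ i)
  · simpa [rename_esymmOn] using esymmOn_mem_powEsymmIdeal hj

lemma rename_mem_packedIdeal {n s : ℕ} (σ : Equiv.Perm (Fin n)) {f : MvPolynomial (Fin n) ℚ}
    (hf : f ∈ packedIdeal n s) : rename σ f ∈ packedIdeal n s := by
  suffices packedIdeal n s ≤ (packedIdeal n s).comap (rename σ) from this hf
  refine sup_le (Ideal.span_le.2 ?_) (Ideal.span_le.2 ?_)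
  · rintro _ ⟨i, r, d, hr, hrd, rfl⟩
    refine Ideal.mem_sup_left (Ideal.subset_span ⟨σ i, r, d, hr, hrd, ?_⟩)
    rw [map_mul, map_pow, rename_X, rename_esymmOn]
    congr 2
    ext j
    simp [Finset.mem_map_equiv, Equiv.symm_apply_eq]
  · rintro _ ⟨j, hj, rfl⟩
    simpa [rename_esymmOn] using esymmOn_mem_packedIdeal hj

attribute [local instance] MvPolynomial.gradedAlgebra in
lemma homogeneousComponent_mem_packedIdeal {n s : ℕ} (d : ℕ) {f : MvPolynomial (Fin n) ℚ}
    (hf : f ∈ packedIdeal n s) : homogeneousComponent d f ∈ packedIdeal n s := by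
  refine homogeneousComponent_mem_of_mem (Ideal.IsHomogeneous.sup ?_ ?_) hf d
  · refine Ideal.homogeneous_span _ _ ?_
    rintro _ ⟨i, r, d, -, -, rfl⟩
    exact ⟨_, (isHomogeneous_X_pow i d).mul (isHomogeneous_esymmOn n _ _)⟩
  · refine Ideal.homogeneous_span _ _ ?_
    rintro _ ⟨j, -, rfl⟩
    exact ⟨_, isHomogeneous_esymmOn n _ _⟩

lemma exists_homogeneous_sub_mul_mem {n k d : ℕ} {f : MvPolynomial (Fin n) ℚ}
    (hf : f ∈ packedIdeal n (k + 1)) (hfd : f.IsHomogeneous d) :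
    f ∈ packedIdeal n k ∨ n - k ≤ d ∧ ∃ h : MvPolynomial (Fin n) ℚ,
      h.IsHomogeneous (d - (n - k)) ∧
        f - esymmOn n Finset.univ (n - k) * h ∈ packedIdeal n k := by
  obtain ⟨h, hh⟩ := exists_sub_mul_mem_packedIdeal hf
  have h1 := homogeneousComponent_mem_packedIdeal d hh
  rw [map_sub, homogeneousComponent_eq_self hfd, mul_comm] at h1
  rcases lt_or_ge d (n - k) with hd | hd
  · left
    rwa [homogeneousComponent_mul_eq_zero _ (isHomogeneous_esymmOn n _ _) hd, sub_zero] at h1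
  · right
    obtain ⟨c, rfl⟩ := Nat.exists_eq_add_of_le' hd
    rw [homogeneousComponent_add_mul _ (isHomogeneous_esymmOn n _ _), mul_comm] at h1
    refine ⟨hd, homogeneousComponent c h, ?_, h1⟩
    rw [Nat.add_sub_cancel]
    exact homogeneousComponent_isHomogeneous c h

lemma mem_quotCompShift {n : ℕ} {I : Ideal (MvPolynomial (Fin n) ℚ)} {d a : ℕ}
    {y : MvPolynomial (Fin n) ℚ ⧸ I} :
    y ∈ quotCompShift n I d a ↔ ∃ h : MvPolynomial (Fin n) ℚ, quotMap I h = y ∧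
      (h = 0 ∨ a ≤ d ∧ h.IsHomogeneous (d - a)) := by
  rw [quotCompShift]
  split_ifs with had
  · constructor
    · rintro ⟨h, hh, rfl⟩
      exact ⟨h, rfl, Or.inr ⟨had, hh⟩⟩
    · rintro ⟨h, rfl, rfl | ⟨-, hh⟩⟩
      · rw [map_zero]; exact zero_mem _
      · exact ⟨h, hh, rfl⟩
  · rw [Submodule.mem_bot]
    constructor
    · rintro rfl
      exact ⟨0, map_zero _, Or.inl rfl⟩
    · rintro ⟨h, rfl, rfl | ⟨h', -⟩⟩
      · exact map_zero _
      · exact (had h').elim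

lemma exists_rename_quotMap {n : ℕ} {I : Ideal (MvPolynomial (Fin n) ℚ)}
    (hI : ∀ (σ : Equiv.Perm (Fin n)), ∀ f ∈ I, rename σ f ∈ I) :
    ∃ ρ : Equiv.Perm (Fin n) → (MvPolynomial (Fin n) ℚ ⧸ I) →ₗ[ℚ] (MvPolynomial (Fin n) ℚ ⧸ I),
      ∀ σ f, ρ σ (quotMap I f) = quotMap I (rename σ f) := by
  have h (σ : Equiv.Perm (Fin n)) := exists_linearMap_comp_eq (quotMap_surjective I)
    (f := quotMap I ∘ₗ (rename σ : MvPolynomial (Fin n) ℚ →ₐ[ℚ] _).toLinearMap)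
    fun f hf => quotMap_eq_zero.2 (hI σ f (quotMap_eq_zero.1 hf))
  choose ρ hρ using h
  exact ⟨ρ, hρ⟩

/-- Averaging over the symmetric group: a linear left inverse of multiplication by `e`
can be made equivariant. -/
theorem exists_equivariant_leftInverse {n : ℕ} {I J : Ideal (MvPolynomial (Fin n) ℚ)}
    (hI : ∀ (σ : Equiv.Perm (Fin n)), ∀ f ∈ I, rename σ f ∈ I)
    (hJ : ∀ (σ : Equiv.Perm (Fin n)), ∀ f ∈ J, rename σ f ∈ J)
    {e : MvPolynomial (Fin n) ℚ} (he : ∀ σ : Equiv.Perm (Fin n), rename σ e = e)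
    (hIJ : ∀ h, e * h ∈ J ↔ h ∈ I) (d a : ℕ) :
    ∃ π : MvPolynomial (Fin n) ℚ →ₗ[ℚ] (MvPolynomial (Fin n) ℚ ⧸ I),
      (∀ f ∈ J, π f = 0) ∧ (∀ f, π f ∈ quotCompShift n I d a) ∧
      (∀ h, quotMap I h ∈ quotCompShift n I d a → π (e * h) = quotMap I h) ∧
      ∀ (σ : Equiv.Perm (Fin n)) (f g : MvPolynomial (Fin n) ℚ),
        π f = quotMap I g → π (rename σ f) = quotMap I (rename σ g) := by
  classical
  obtain ⟨ρ, hρ⟩ := exists_rename_quotMap hI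
  obtain ⟨μ, hμ⟩ := exists_linearMap_comp_eq (quotMap_surjective I)
    (f := quotMap J ∘ₗ LinearMap.mulLeft ℚ e)
    fun h hh => quotMap_eq_zero.2 ((hIJ h).2 (quotMap_eq_zero.1 hh))
  have hρmul (σ τ : Equiv.Perm (Fin n)) (y) : ρ (σ * τ) y = ρ σ (ρ τ y) := by
    obtain ⟨f, rfl⟩ := quotMap_surjective I y
    rw [hρ, hρ, hρ, rename_rename]
    rfl
  have hρA (σ : Equiv.Perm (Fin n)) (y) (hy : y ∈ quotCompShift n I d a) :
      ρ σ y ∈ quotCompShift n I d a := by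
    obtain ⟨h, rfl, hh⟩ := mem_quotCompShift.1 hy
    refine mem_quotCompShift.2 ⟨rename σ h, (hρ σ h).symm, ?_⟩
    rcases hh with rfl | ⟨h1, h2⟩
    · exact Or.inl (map_zero _)
    · exact Or.inr ⟨h1, h2.rename_isHomogeneous⟩
  have hinj : LinearMap.ker (μ ∘ₗ (quotCompShift n I d a).subtype) = ⊥ := by
    rw [LinearMap.ker_eq_bot']
    rintro ⟨y, hy⟩ h0
    obtain ⟨h, rfl⟩ := quotMap_surjective I y
    have h1 : μ (quotMap I h) = 0 := h0
    rw [hμ] at h1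
    exact Subtype.ext (quotMap_eq_zero.2 ((hIJ h).1 (quotMap_eq_zero.1 h1)))
  obtain ⟨l, hl⟩ := LinearMap.exists_leftInverse_of_injective _ hinj
  let ren (σ : Equiv.Perm (Fin n)) : MvPolynomial (Fin n) ℚ →ₗ[ℚ] MvPolynomial (Fin n) ℚ :=
    (rename σ : MvPolynomial (Fin n) ℚ →ₐ[ℚ] _).toLinearMap
  let π : MvPolynomial (Fin n) ℚ →ₗ[ℚ] (MvPolynomial (Fin n) ℚ ⧸ I) :=
    (Fintype.card (Equiv.Perm (Fin n)) : ℚ)⁻¹ • ∑ σ : Equiv.Perm (Fin n),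
      ρ σ ∘ₗ (quotCompShift n I d a).subtype ∘ₗ l ∘ₗ quotMap J ∘ₗ ren σ⁻¹
  have hπ (f) : π f = (Fintype.card (Equiv.Perm (Fin n)) : ℚ)⁻¹ • ∑ σ : Equiv.Perm (Fin n),
      ρ σ (l (quotMap J (rename (σ⁻¹ : Equiv.Perm (Fin n)) f))) := by
    simp [π, ren]
  refine ⟨π, fun f hf => ?_, fun f => ?_, fun h hh => ?_, fun σ f g hfg => ?_⟩
  · rw [hπ, Finset.sum_eq_zero, smul_zero]
    intro σ _
    rw [quotMap_eq_zero.2 (hJ _ f hf)]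
    simp
  · rw [hπ]
    exact Submodule.smul_mem _ _ (Submodule.sum_mem _ fun σ _ => hρA σ _ (Subtype.prop _))
  · have hterm (σ : Equiv.Perm (Fin n)) :
        ρ σ (l (quotMap J (rename (σ⁻¹ : Equiv.Perm (Fin n)) (e * h)))) = quotMap I h := by
      have h1 : quotMap I (rename (σ⁻¹ : Equiv.Perm (Fin n)) h) ∈ quotCompShift n I d a := by
        rw [← hρ]; exact hρA _ _ hh
      have h2 := LinearMap.congr_fun hl ⟨_, h1⟩
      have h3 : μ (quotMap I (rename (σ⁻¹ : Equiv.Perm (Fin n)) h)) =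
          quotMap J (rename (σ⁻¹ : Equiv.Perm (Fin n)) (e * h)) := by
        rw [hμ, map_mul, he]; rfl
      simp only [LinearMap.comp_apply, Submodule.subtype_apply, h3, LinearMap.id_apply] at h2
      rw [h2, hρ, rename_rename]
      simp
    rw [hπ, Finset.sum_congr rfl fun σ _ => hterm σ, Finset.sum_const, Finset.card_univ,
      ← Nat.cast_smul_eq_nsmul ℚ, smul_smul, inv_mul_cancel₀ (by simp [Fintype.card_ne_zero]),
      one_smul]
  · rw [← hρ, ← hfg, hπ, hπ, map_smul, map_sum]
    congr 1
    rw [← Equiv.sum_comp (Equiv.mulLeft σ)]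
    refine Finset.sum_congr rfl fun τ _ => ?_
    rw [← hρmul, rename_rename, Equiv.coe_mulLeft, mul_inv_rev, ← Equiv.Perm.coe_mul,
      inv_mul_cancel_right]

lemma exists_projection {n j : ℕ} (hj : 1 ≤ j) (hjn : j ≤ n) (d : ℕ) :
    ∃ π : MvPolynomial (Fin n) ℚ →ₗ[ℚ] (MvPolynomial (Fin n) ℚ ⧸ Ink n j),
      (∀ f ∈ packedIdeal n j, π f = 0) ∧
      (∀ f, π f ∈ quotCompShift n (Ink n j) d (n - j)) ∧
      (∀ h, quotMap (Ink n j) h ∈ quotCompShift n (Ink n j) d (n - j) →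
        π (esymmOn n Finset.univ (n - j) * h) = quotMap (Ink n j) h) ∧
      ∀ (σ : Equiv.Perm (Fin n)) (f g : MvPolynomial (Fin n) ℚ),
        π f = quotMap (Ink n j) g → π (rename σ f) = quotMap (Ink n j) (rename σ g) := by
  rw [Ink_eq hjn]
  exact exists_equivariant_leftInverse (fun σ f => rename_mem_powEsymmIdeal σ)
    (fun σ f => rename_mem_packedIdeal σ) (fun σ => by simp [rename_esymmOn])
    (fun h => ⟨mem_powEsymmIdeal_of_mul_mem hj hjn, esymmOn_mul_mem_packedIdeal hj hjn⟩) d (n - j)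

/-- for `1 ≤ k ≤ n` and every degree `d`, there is an isomorphism of
`S_n`-representations `(S_{n,k})_d ≅ ⊕_{j=k}^n (R_{n,j})_{d-(n-j)}` (components in negative
degree being zero); equivalently `S_{n,k} ≅ R_{n,n}⟨0⟩ ⊕ ⋯ ⊕ R_{n,k}⟨-(n-k)⟩` as graded
`S_n`-modules.  Equivariance is expressed via representatives: if `v, w` are classes of
`f` and `rename σ f`, and coordinate `j` of `e v` is the class of `g`, then coordinate `j`
of `e w` is the class of `rename σ g`. -/
theorem graded_decomposition (n k : ℕ) (hk : 1 ≤ k) (hkn : k ≤ n) (d : ℕ) :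
    ∃ e : (quotComp n (Jnk n k) d) ≃ₗ[ℚ]
        ((j : Finset.Icc k n) → quotCompShift n (Ink n (j : ℕ)) d (n - (j : ℕ))),
      ∀ (σ : Equiv.Perm (Fin n)) (f g : MvPolynomial (Fin n) ℚ)
        (v w : quotComp n (Jnk n k) d) (j : Finset.Icc k n),
        (v : MvPolynomial (Fin n) ℚ ⧸ Jnk n k) = Ideal.Quotient.mk (Jnk n k) f →
        (w : MvPolynomial (Fin n) ℚ ⧸ Jnk n k) =
          Ideal.Quotient.mk (Jnk n k) (MvPolynomial.rename σ f) →
        ((e v j : MvPolynomial (Fin n) ℚ ⧸ Ink n (j : ℕ)) =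
          Ideal.Quotient.mk (Ink n (j : ℕ)) g) →
        ((e w j : MvPolynomial (Fin n) ℚ ⧸ Ink n (j : ℕ)) =
          Ideal.Quotient.mk (Ink n (j : ℕ)) (MvPolynomial.rename σ g)) := by
  choose! π hπJ hπA hπe hπσ using fun (j : Finset.Icc k n) =>
    exists_projection (hk.trans (Finset.mem_Icc.1 j.2).1) (Finset.mem_Icc.1 j.2).2 d
  rw [Jnk_eq hkn]
  let Φ : MvPolynomial (Fin n) ℚ →ₗ[ℚ]
      ((j : Finset.Icc k n) → quotCompShift n (Ink n (j : ℕ)) d (n - (j : ℕ))) :=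
    LinearMap.pi fun j => (π j).codRestrict _ (hπA j)
  have hΦ (f) (j : Finset.Icc k n) : (Φ f j : MvPolynomial (Fin n) ℚ ⧸ Ink n (j : ℕ)) = π j f := rfl
  have hΦ0 (f) (hf : quotMap (packedIdeal n k) f = 0) : Φ f = 0 := by
    refine funext fun j => Subtype.ext ?_
    exact hπJ j f (packedIdeal_mono n (Finset.mem_Icc.1 j.2).1 (quotMap_eq_zero.1 hf))
  obtain ⟨Ψ, hΨ⟩ := exists_linearMap_comp_eq (quotMap_surjective (packedIdeal n k))
    (U := (j : Finset.Icc k n) → quotCompShift n (Ink n (j : ℕ)) d (n - (j : ℕ))) (f := Φ) hΦ0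
  let e₀ := Ψ ∘ₗ (quotComp n (packedIdeal n k) d).subtype
  have hinj : Function.Injective e₀ := by
    refine (injective_iff_map_eq_zero e₀).2 ?_
    rintro ⟨_, f, hf, rfl⟩ h0
    have h0' (j : Finset.Icc k n) : π j f = 0 := by
      rw [← hΦ, ← hΨ]
      exact congrArg Subtype.val (congrFun h0 j)
    refine Subtype.ext (quotMap_eq_zero.2 ?_)
    have key (a : ℕ) (m : ℕ) (hkm : k ≤ m) (hm : m + a = n + 1) : f ∈ packedIdeal n m := by
      induction a generalizing m with
      | zero =>
        have := esymmOn_mem_packedIdeal (n := n) (s := m) (j := 0) (by omega)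
        rw [esymmOn_eq, esymFun_zero] at this
        rw [(Ideal.eq_top_iff_one _).2 this]
        trivial
      | succ a ih =>
        rcases exists_homogeneous_sub_mul_mem (ih (m + 1) (by omega) (by omega)) hf with
          h | ⟨hd, h, hh, hfh⟩
        · exact h
        let j : Finset.Icc k n := ⟨m, Finset.mem_Icc.2 ⟨hkm, by omega⟩⟩
        have h1 := hπe j h (mem_quotCompShift.2 ⟨h, rfl, Or.inr ⟨hd, hh⟩⟩)
        have h2 := hπJ j _ hfh
        rw [map_sub, h0', zero_sub, neg_eq_zero] at h2
        have h3 : h ∈ powEsymmIdeal n m m := by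
          rw [← Ink_eq (by omega), ← quotMap_eq_zero]
          exact h1.symm.trans h2
        have := add_mem hfh (esymmOn_mul_mem_packedIdeal (hk.trans hkm) (by omega) h3)
        rwa [sub_add_cancel] at this
    exact key (n + 1 - k) k le_rfl (by omega)
  have hsurj : Function.Surjective e₀ := by
    intro u
    have key (a : ℕ) (m : ℕ) (hkm : k ≤ m) (hm : m + a = n + 1) :
        ∃ f : MvPolynomial (Fin n) ℚ, f.IsHomogeneous d ∧
          ∀ j : Finset.Icc k n, m ≤ j → Φ f j = u j := by
      induction a generalizing m with
      | zero =>
        refine ⟨0, isHomogeneous_zero _ _ _, fun j hj => ?_⟩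
        have := (Finset.mem_Icc.1 j.2).2
        omega
      | succ a ih =>
        obtain ⟨f, hf, hfu⟩ := ih (m + 1) (by omega) (by omega)
        let i : Finset.Icc k n := ⟨m, Finset.mem_Icc.2 ⟨hkm, by omega⟩⟩
        obtain ⟨h, hh, hhd⟩ := mem_quotCompShift.1 (u i - Φ f i).2
        refine ⟨f + esymmOn n Finset.univ (n - m) * h, hf.add ?_, fun j hj => ?_⟩
        · rcases hhd with rfl | ⟨hd, hhd⟩
          · rw [mul_zero]
            exact isHomogeneous_zero _ _ _
          · have := (isHomogeneous_esymmOn n Finset.univ (n - m)).mul hhd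
            rwa [show n - m + (d - (n - m)) = d from Nat.add_sub_cancel' hd] at this
        · refine Subtype.ext ?_
          rw [hΦ, map_add]
          rcases hj.eq_or_lt with hj | hj
          · obtain rfl : i = j := Subtype.ext hj
            rw [hπe i h (by rw [hh]; exact (u i - Φ f i).2), hh, ← hΦ]
            simp
          · rw [hπJ j (esymmOn n Finset.univ (n - m) * h)
              (Ideal.mul_mem_right _ _ (esymmOn_mem_packedIdeal (by omega))), add_zero, ← hΦ,
              hfu j hj]
    obtain ⟨f, hf, hfu⟩ := key (n + 1 - k) k le_rfl (by omega)
    refine ⟨⟨quotMap _ f, f, hf, rfl⟩, ?_⟩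
    exact (hΨ f).trans (funext fun j => hfu j (Finset.mem_Icc.1 j.2).1)
  refine ⟨LinearEquiv.ofBijective e₀ ⟨hinj, hsurj⟩, fun σ f g v w j hv hw hvg => ?_⟩
  have he (v : quotComp n (packedIdeal n k) d) (f : MvPolynomial (Fin n) ℚ)
      (hv : (v : MvPolynomial (Fin n) ℚ ⧸ packedIdeal n k) = Ideal.Quotient.mk _ f) :
      ((e₀ v j : MvPolynomial (Fin n) ℚ ⧸ Ink n (j : ℕ))) = π j f := by
    rw [← hΦ, ← hΨ, quotMap_apply, ← hv]
    rfl
  exact (he w _ hw).trans (hπσ j σ f g ((he v f hv).symm.trans hvg))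

end PackedWords
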